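/- Let Λ = {x ∈ ℤ⁴ : x₁ + x₂ + x₃ + x₄ ∈ 2ℤ} (the dual lattice of the root system F₄) and let P = conv{(−1,0,1,0), (−1,−1,1,−1), (0,0,0,0), (−1,1,1,−1), (0,0,2,0)}. Then P is a 4-dimensional simplex whose only Λ-points are its five vertices, the point (−1,0,2,−1) lies in Λ ∩ 2P but is not the sum of two points of P ∩ Λ; consequently P is not integrally closed with respect to Λ and admits no unimodular triangulation. -/

import Mathlib

/-- `x` is a point of the standard lattice `ℤ^d ⊆ ℝ^d`. -/
def Zd {d : ℕ} (x : Fin d → ℝ) : Prop := ∀ i, ∃ z : ℤ, x i = (z : ℝ)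

/-- `x` lies in the affine lattice generated (over `ℤ`) by the finite point set `F`. -/
def InAffLat {E : Type*} [AddCommGroup E] [Module ℝ E] (F : Finset E) (x : E) : Prop :=
  ∃ c : E → ℤ, (∀ a, a ∉ F → c a = 0) ∧ (∑ a ∈ F, c a) = 1 ∧ (∑ a ∈ F, (c a : ℝ) • a) = x

/-- `F` is the vertex set of a unimodular simplex with respect to the lattice predicate `L`:
its vertices are affinely independent lattice points which affinely generate every lattice
point of their affine span. -/
def UnimodularFinset {E : Type*} [AddCommGroup E] [Module ℝ E] (L : E → Prop)
    (F : Finset E) : Prop :=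
  (∀ a ∈ F, L a) ∧ AffineIndependent ℝ (fun p : F => (p : E)) ∧
    ∀ x, L x → x ∈ affineSpan ℝ (F : Set E) → InAffLat F x

/-- A (geometric) triangulation of the set `P`, recorded by the vertex sets of its faces:
faces are affinely independent, the collection is closed under taking subsets, convex hulls
of faces intersect in the convex hull of the common vertices, and the faces cover `P`. -/
def IsTriangulation {E : Type*} [AddCommGroup E] [Module ℝ E]
    (P : Set E) (T : Finset (Finset E)) : Prop :=
  (∀ F ∈ T, AffineIndependent ℝ (fun p : F => (p : E))) ∧
  (∀ F ∈ T, ∀ G, G ⊆ F → G ∈ T) ∧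
  (∀ F ∈ T, ∀ G ∈ T,
    convexHull ℝ (F : Set E) ∩ convexHull ℝ (G : Set E) =
      convexHull ℝ ((F : Set E) ∩ (G : Set E))) ∧
  (⋃ F ∈ T, convexHull ℝ (F : Set E)) = P

/-- `F` is a maximal cell of the triangulation `T`. -/
def MaxCell {E : Type*} (T : Finset (Finset E)) (F : Finset E) : Prop :=
  F ∈ T ∧ ∀ G ∈ T, F ⊆ G → G = F

/-- A triangulation is unimodular when all of its maximal cells are unimodular simplices. -/
def IsUnimodular {E : Type*} [AddCommGroup E] [Module ℝ E] (L : E → Prop)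
    (T : Finset (Finset E)) : Prop :=
  ∀ F, MaxCell T F → UnimodularFinset L F

/-- A triangulation is regular when its maximal cells are the domains of linearity of a
piecewise linear convex function on `P`. -/
def IsRegularTri {E : Type*} [AddCommGroup E] [Module ℝ E]
    (P : Set E) (T : Finset (Finset E)) : Prop :=
  ∃ f : E → ℝ, ConvexOn ℝ P f ∧
    (∀ F, MaxCell T F → ∃ g : E →ᵃ[ℝ] ℝ, Set.EqOn f (⇑g) (convexHull ℝ (F : Set E))) ∧
    (∀ F G, MaxCell T F → MaxCell T G → F ≠ G →
      ¬ ∃ g : E →ᵃ[ℝ] ℝ,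
        Set.EqOn f (⇑g) (convexHull ℝ (F : Set E) ∪ convexHull ℝ (G : Set E)))

/-- `N` is a minimal non-face of the triangulation `T`: a set of vertices of `T` which is
not a face, all of whose proper subsets are faces. -/
def MinNonFace {E : Type*} (T : Finset (Finset E)) (N : Finset E) : Prop :=
  (∀ x ∈ N, ({x} : Finset E) ∈ T) ∧ N ∉ T ∧ ∀ M, M ⊂ N → M ∈ T

/-- A triangulation is flag when all of its minimal non-faces have exactly two elements. -/
def IsFlag {E : Type*} (T : Finset (Finset E)) : Prop :=
  ∀ N, MinNonFace T N → N.card = 2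

/-- A triangulation of `P` is full when every lattice point of `P` is one of its vertices. -/
def IsFull {E : Type*} (L : E → Prop) (P : Set E) (T : Finset (Finset E)) : Prop :=
  ∀ x ∈ P, L x → ({x} : Finset E) ∈ T

/-- `P` is a lattice polytope with respect to the lattice predicate `L`. -/
def IsLatticePolytope {E : Type*} [AddCommGroup E] [Module ℝ E] (L : E → Prop)
    (P : Set E) : Prop :=
  ∃ V : Finset E, V.Nonempty ∧ (∀ v ∈ V, L v) ∧ P = convexHull ℝ (V : Set E)

/-- `x` belongs to the dual lattice of the root system `F₄`:
`Λ = {x ∈ ℤ⁴ : x₁ + x₂ + x₃ + x₄ ∈ 2ℤ}`. -/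
def LF4 (x : Fin 4 → ℝ) : Prop :=
  (∀ i, ∃ z : ℤ, x i = (z : ℝ)) ∧ ∃ z : ℤ, (∑ i, x i) = 2 * (z : ℝ)

/-- The vertices of the simplex `P`. -/
def F4Vertex : Fin 5 → (Fin 4 → ℝ) :=
  ![![-1, 0, 1, 0], ![-1, -1, 1, -1], ![0, 0, 0, 0], ![-1, 1, 1, -1], ![0, 0, 2, 0]]

theorem exists_weights_of_mem_convexHull_range {ι E : Type*} [Fintype ι] [AddCommGroup E]
    [Module ℝ E] {v : ι → E} {x : E} (hx : x ∈ convexHull ℝ (Set.range v)) :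
    ∃ w : ι → ℝ, (∀ i, 0 ≤ w i) ∧ ∑ i, w i = 1 ∧ ∑ i, w i • v i = x := by
  classical
  have hsub : convexHull ℝ (Set.range v) ⊆ Fintype.linearCombination ℝ v '' stdSimplex ℝ ι := by
    refine convexHull_min ?_ ((convex_stdSimplex ℝ ι).linear_image _)
    rintro _ ⟨i, rfl⟩
    exact ⟨Pi.single i 1, single_mem_stdSimplex ℝ i, by simp⟩
  obtain ⟨w, hw, rfl⟩ := hsub hx
  exact ⟨w, hw.1, hw.2, by simp [Fintype.linearCombination_apply]⟩

theorem affineIndependent_F4Vertex : AffineIndependent ℝ F4Vertex := by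
  rw [affineIndependent_iff_of_fintype]
  intro w hw h
  rw [Finset.univ.weightedVSub_eq_weightedVSubOfPoint_of_sum_eq_zero w _ hw 0,
    Finset.weightedVSubOfPoint_apply] at h
  have h0 := congrFun h 0
  have h1 := congrFun h 1
  have h2 := congrFun h 2
  have h3 := congrFun h 3
  simp [F4Vertex, Fin.sum_univ_five] at h0 h1 h2 h3 hw
  intro i
  fin_cases i <;> dsimp <;> linarith

theorem eq_F4Vertex_of_mem_convexHull {x : Fin 4 → ℝ}
    (hx : x ∈ convexHull ℝ (Set.range F4Vertex)) (hL : LF4 x) : ∃ i, x = F4Vertex i := by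
  obtain ⟨w, hw, hsum, rfl⟩ := exists_weights_of_mem_convexHull_range hx
  obtain ⟨hz, t, ht⟩ := hL
  obtain ⟨z0, h0⟩ := hz 0
  obtain ⟨z1, h1⟩ := hz 1
  obtain ⟨z2, h2⟩ := hz 2
  obtain ⟨z3, h3⟩ := hz 3
  have w0 := hw 0
  have w1 := hw 1
  have w2 := hw 2
  have w3 := hw 3
  have w4 := hw 4
  rw [Fin.sum_univ_four, h0, h1, h2, h3] at ht
  norm_cast at ht
  simp [F4Vertex, Fin.sum_univ_five] at h0 h1 h2 h3
  rw [Fin.sum_univ_five] at hsum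
  have hz0 : -1 ≤ z0 ∧ z0 ≤ 0 := by
    constructor <;> (rify; linarith)
  have hz3 : -1 ≤ z3 ∧ z3 ≤ 0 := by
    constructor <;> (rify; linarith)
  have hz1 : z3 ≤ z1 ∧ z1 ≤ -z3 := by
    constructor <;> (rify; linarith)
  have hz2 : -z0 ≤ z2 ∧ z2 ≤ 2 + z0 := by
    constructor <;> (rify; linarith)
  have hz30 : z0 ≤ z3 := by rify; linarith
  have hcases : (z0 = -1 ∧ z1 = 0 ∧ z2 = 1 ∧ z3 = 0) ∨ (z0 = -1 ∧ z1 = -1 ∧ z2 = 1 ∧ z3 = -1) ∨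
      (z0 = 0 ∧ z1 = 0 ∧ z2 = 0 ∧ z3 = 0) ∨ (z0 = -1 ∧ z1 = 1 ∧ z2 = 1 ∧ z3 = -1) ∨
      (z0 = 0 ∧ z1 = 0 ∧ z2 = 2 ∧ z3 = 0) := by
    omega
  rcases hcases with ⟨rfl, rfl, rfl, rfl⟩ | ⟨rfl, rfl, rfl, rfl⟩ | ⟨rfl, rfl, rfl, rfl⟩ |
    ⟨rfl, rfl, rfl, rfl⟩ | ⟨rfl, rfl, rfl, rfl⟩
  · refine ⟨0, funext fun j => ?_⟩
    fin_cases j <;> simp [F4Vertex, Fin.sum_univ_five] <;> push_cast at * <;> linarith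
  · refine ⟨1, funext fun j => ?_⟩
    fin_cases j <;> simp [F4Vertex, Fin.sum_univ_five] <;> push_cast at * <;> linarith
  · refine ⟨2, funext fun j => ?_⟩
    fin_cases j <;> simp [F4Vertex, Fin.sum_univ_five] <;> push_cast at * <;> linarith
  · refine ⟨3, funext fun j => ?_⟩
    fin_cases j <;> simp [F4Vertex, Fin.sum_univ_five] <;> push_cast at * <;> linarith
  · refine ⟨4, funext fun j => ?_⟩
    fin_cases j <;> simp [F4Vertex, Fin.sum_univ_five] <;> push_cast at * <;> linarith

theorem F4Vertex_parity (i : Fin 5) : ∃ z : ℤ, F4Vertex i 1 + F4Vertex i 3 = 2 * (z : ℝ) := by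
  fin_cases i
  · exact ⟨0, by simp [F4Vertex]⟩
  · exact ⟨-1, by simp [F4Vertex]; norm_num⟩
  · exact ⟨0, by simp [F4Vertex]⟩
  · exact ⟨0, by simp [F4Vertex]⟩
  · exact ⟨0, by simp [F4Vertex]⟩

theorem LF4_sum_two_center : LF4 ![-1, 0, 2, -1] := by
  refine ⟨fun i => ?_, 0, by simp [Fin.sum_univ_four]; norm_num⟩
  fin_cases i
  · exact ⟨-1, by simp⟩
  · exact ⟨0, by simp⟩
  · exact ⟨2, by simp⟩
  · exact ⟨-1, by simp⟩

theorem F4_center_mem_convexHull :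
    (![-1 / 2, 0, 1, -1 / 2] : Fin 4 → ℝ) ∈ convexHull ℝ (Set.range F4Vertex) := by
  refine mem_convexHull_of_exists_fintype ![0, 1 / 4, 1 / 4, 1 / 4, 1 / 4] F4Vertex ?_ ?_
    (fun i => Set.mem_range_self i) ?_
  · intro i
    fin_cases i <;> simp
  · simp [Fin.sum_univ_five]
    norm_num
  · ext j
    fin_cases j <;> simp [F4Vertex, Fin.sum_univ_five] <;> norm_num

theorem two_smul_F4_center :
    (2 : ℝ) • (![-1 / 2, 0, 1, -1 / 2] : Fin 4 → ℝ) = ![-1, 0, 2, -1] := by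
  ext j
  fin_cases j <;> norm_num

theorem not_sum_two_F4_points :
    ¬ ∃ a b : Fin 4 → ℝ, a ∈ convexHull ℝ (Set.range F4Vertex) ∧ LF4 a ∧
      b ∈ convexHull ℝ (Set.range F4Vertex) ∧ LF4 b ∧ a + b = ![-1, 0, 2, -1] := by
  rintro ⟨a, b, ha, hLa, hb, hLb, hab⟩
  obtain ⟨i, rfl⟩ := eq_F4Vertex_of_mem_convexHull ha hLa
  obtain ⟨j, rfl⟩ := eq_F4Vertex_of_mem_convexHull hb hLb
  obtain ⟨y, hy⟩ := F4Vertex_parity i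
  obtain ⟨z, hz⟩ := F4Vertex_parity j
  have h1 := congrFun hab 1
  have h3 := congrFun hab 3
  simp at h1 h3
  have h : (2 * (y + z) : ℝ) = -1 := by linarith
  norm_cast at h
  omega

/-- The origin is the only vertex outside the half-space `2 ≤ x₃ - x₁`, and the centre also lies
outside of it. -/
theorem zero_mem_of_F4_center_mem {G : Finset (Fin 4 → ℝ)} (hG : ∀ a ∈ G, ∃ i, a = F4Vertex i)
    (hm : (![-1 / 2, 0, 1, -1 / 2] : Fin 4 → ℝ) ∈ convexHull ℝ (G : Set (Fin 4 → ℝ))) :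
    (0 : Fin 4 → ℝ) ∈ G := by
  by_contra h0
  let f : (Fin 4 → ℝ) →ₗ[ℝ] ℝ :=
    LinearMap.proj (R := ℝ) (φ := fun _ : Fin 4 => ℝ) 2 - LinearMap.proj 0
  have hsub : convexHull ℝ (G : Set (Fin 4 → ℝ)) ⊆ {x | 2 ≤ f x} := by
    refine convexHull_min (fun a ha => ?_) (convex_halfSpace_ge f.isLinear 2)
    obtain ⟨i, rfl⟩ := hG a ha
    fin_cases i
    · simp [f, F4Vertex]; norm_num
    · simp [f, F4Vertex]; norm_num
    · refine absurd ?_ h0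
      convert Finset.mem_coe.1 ha using 1
      ext j
      fin_cases j <;> simp [F4Vertex]
    · simp [f, F4Vertex]; norm_num
    · simp [f, F4Vertex]
  have h := hsub hm
  simp [f] at h
  norm_num at h

theorem InAffLat.F4_parity {G : Finset (Fin 4 → ℝ)} (hG : ∀ a ∈ G, ∃ i, a = F4Vertex i)
    {x : Fin 4 → ℝ} (hx : InAffLat G x) : ∃ z : ℤ, x 1 + x 3 = 2 * (z : ℝ) := by
  obtain ⟨c, -, -, rfl⟩ := hx
  have hp : ∀ a ∈ G, ∃ z : ℤ, a 1 + a 3 = 2 * (z : ℝ) := by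
    intro a ha
    obtain ⟨i, rfl⟩ := hG a ha
    exact F4Vertex_parity i
  choose! z hz using hp
  refine ⟨∑ a ∈ G, c a * z a, ?_⟩
  simp only [Finset.sum_apply, Pi.smul_apply, smul_eq_mul]
  rw [← Finset.sum_add_distrib]
  push_cast
  rw [Finset.mul_sum]
  refine Finset.sum_congr rfl fun a ha => ?_
  linear_combination (c a : ℝ) * hz a ha

theorem IsTriangulation.exists_maxCell {E : Type*} [AddCommGroup E] [Module ℝ E] {P : Set E}
    {T : Finset (Finset E)} (hT : IsTriangulation P T) {x : E} (hx : x ∈ P) :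
    ∃ G, MaxCell T G ∧ x ∈ convexHull ℝ (G : Set E) := by
  rw [← hT.2.2.2] at hx
  simp only [Set.mem_iUnion] at hx
  obtain ⟨F, hF, hxF⟩ := hx
  obtain ⟨G, hFG, hG⟩ := T.finite_toSet.exists_le_maximal hF
  exact ⟨G, ⟨hG.1, fun H hH hGH => (hG.eq_of_le hH hGH).symm⟩,
    convexHull_mono (Finset.coe_subset.2 hFG) hxF⟩

theorem not_exists_unimodular_triangulation_F4 :
    ¬ ∃ T : Finset (Finset (Fin 4 → ℝ)),
      IsTriangulation (convexHull ℝ (Set.range F4Vertex)) T ∧ IsUnimodular LF4 T := by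
  rintro ⟨T, hT, hU⟩
  obtain ⟨G, hG, hm⟩ := hT.exists_maxCell F4_center_mem_convexHull
  obtain ⟨hL, -, hgen⟩ := hU G hG
  have hV : ∀ a ∈ G, ∃ i, a = F4Vertex i := fun a ha =>
    eq_F4Vertex_of_mem_convexHull
      (hT.2.2.2 ▸ Set.mem_biUnion (Finset.mem_coe.2 hG.1)
        (subset_convexHull ℝ (G : Set (Fin 4 → ℝ)) ha)) (hL a ha)
  have hspan : (![-1, 0, 2, -1] : Fin 4 → ℝ) ∈ affineSpan ℝ (G : Set (Fin 4 → ℝ)) := by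
    have h := AffineMap.lineMap_mem (2 : ℝ)
      (subset_affineSpan ℝ (G : Set (Fin 4 → ℝ)) (zero_mem_of_F4_center_mem hV hm))
      (convexHull_subset_affineSpan (𝕜 := ℝ) (G : Set (Fin 4 → ℝ)) hm)
    rwa [AffineMap.lineMap_apply_module, smul_zero, zero_add, two_smul_F4_center] at h
  obtain ⟨z, hz⟩ := (hgen _ LF4_sum_two_center hspan).F4_parity hV
  simp at hz
  have h : (2 * z : ℝ) = -1 := hz.symm
  norm_cast at h
  omega

/-- **A type `F₄` polytope which is not integrally closed.** The simplex
`P = conv{(−1,0,1,0), (−1,−1,1,−1), (0,0,0,0), (−1,1,1,−1), (0,0,2,0)}` (a lattice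
polytope for the dual lattice `Λ` of `F₄`) has no `Λ`-points besides its five vertices;
the point `(−1,0,2,−1) ∈ Λ ∩ 2P` is not a sum of two `Λ`-points of `P`; hence `P` is not
integrally closed with respect to `Λ` and admits no unimodular triangulation. -/
theorem F4_polytope_not_integrally_closed :
    -- the five points are affinely independent, so P is a 4-simplex
    AffineIndependent ℝ
      (![![-1, 0, 1, 0], ![-1, -1, 1, -1], ![0, 0, 0, 0], ![-1, 1, 1, -1], ![0, 0, 2, 0]] :
        Fin 5 → (Fin 4 → ℝ)) ∧
    -- the only Λ-points of P are its five vertices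
    (∀ x ∈ convexHull ℝ
        (Set.range (![![-1, 0, 1, 0], ![-1, -1, 1, -1], ![0, 0, 0, 0], ![-1, 1, 1, -1],
          ![0, 0, 2, 0]] : Fin 5 → (Fin 4 → ℝ))), LF4 x →
      ∃ i : Fin 5,
        x = (![![-1, 0, 1, 0], ![-1, -1, 1, -1], ![0, 0, 0, 0], ![-1, 1, 1, -1],
          ![0, 0, 2, 0]] : Fin 5 → (Fin 4 → ℝ)) i) ∧
    -- (−1,0,2,−1) lies in Λ ∩ 2P …
    (LF4 ![-1, 0, 2, -1] ∧
      (![-1, 0, 2, -1] : Fin 4 → ℝ) ∈ (fun y => (2 : ℝ) • y) '' convexHull ℝ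
        (Set.range (![![-1, 0, 1, 0], ![-1, -1, 1, -1], ![0, 0, 0, 0], ![-1, 1, 1, -1],
          ![0, 0, 2, 0]] : Fin 5 → (Fin 4 → ℝ)))) ∧
    -- … but is not a sum of two Λ-points of P
    (¬ ∃ a b : Fin 4 → ℝ,
        a ∈ convexHull ℝ (Set.range (![![-1, 0, 1, 0], ![-1, -1, 1, -1], ![0, 0, 0, 0],
          ![-1, 1, 1, -1], ![0, 0, 2, 0]] : Fin 5 → (Fin 4 → ℝ))) ∧ LF4 a ∧
        b ∈ convexHull ℝ (Set.range (![![-1, 0, 1, 0], ![-1, -1, 1, -1], ![0, 0, 0, 0],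
          ![-1, 1, 1, -1], ![0, 0, 2, 0]] : Fin 5 → (Fin 4 → ℝ))) ∧ LF4 b ∧
        a + b = ![-1, 0, 2, -1]) ∧
    -- consequently P is not integrally closed with respect to Λ …
    (¬ ∀ (k : ℕ), 0 < k → ∀ x : Fin 4 → ℝ, LF4 x →
        x ∈ (fun y => (k : ℝ) • y) '' convexHull ℝ
          (Set.range (![![-1, 0, 1, 0], ![-1, -1, 1, -1], ![0, 0, 0, 0], ![-1, 1, 1, -1],
            ![0, 0, 2, 0]] : Fin 5 → (Fin 4 → ℝ))) →
        ∃ f : Fin k → (Fin 4 → ℝ),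
          (∀ i, f i ∈ convexHull ℝ (Set.range (![![-1, 0, 1, 0], ![-1, -1, 1, -1],
            ![0, 0, 0, 0], ![-1, 1, 1, -1], ![0, 0, 2, 0]] : Fin 5 → (Fin 4 → ℝ))) ∧
            LF4 (f i)) ∧
          (∑ i, f i) = x) ∧
    -- … and admits no unimodular triangulation
    (¬ ∃ T : Finset (Finset (Fin 4 → ℝ)),
        IsTriangulation (convexHull ℝ (Set.range (![![-1, 0, 1, 0], ![-1, -1, 1, -1],
          ![0, 0, 0, 0], ![-1, 1, 1, -1], ![0, 0, 2, 0]] : Fin 5 → (Fin 4 → ℝ)))) T ∧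
        IsUnimodular LF4 T) := by
  refine ⟨affineIndependent_F4Vertex, fun x => eq_F4Vertex_of_mem_convexHull,
    ⟨LF4_sum_two_center, _, F4_center_mem_convexHull, two_smul_F4_center⟩,
    not_sum_two_F4_points, fun h => ?_, not_exists_unimodular_triangulation_F4⟩
  obtain ⟨f, hf, hsum⟩ := h 2 two_pos _ LF4_sum_two_center
    ⟨_, F4_center_mem_convexHull, by simpa only [Nat.cast_ofNat] using two_smul_F4_center⟩
  exact not_sum_two_F4_points ⟨f 0, f 1, (hf 0).1, (hf 0).2, (hf 1).1, (hf 1).2,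
    by rw [← hsum, Fin.sum_univ_two]⟩
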